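/- Let p > 1, 0 < γ < p − 1, and x₀ ∈ ℝ. Let S₃ = {k ∈ ℂ : −√2 ≤ Im k ≤ 1}. Then there exist C > 0 and a function f₃ : ℝ × S₃ → ℂ², f₃ = (f₃¹, f₃²), such that for every k ∈ S₃: (i) x ↦ f₃(x,k) is twice continuously differentiable and satisfies for all x ∈ ℝ the system −∂_x²f₃¹ + f₃¹ − ((p+1)/2)φ_p^{p−1}f₃¹ − ((p−1)/2)φ_p^{p−1}f₃² = (k²+1)f₃¹ and ∂_x²f₃² − f₃² + ((p−1)/2)φ_p^{p−1}f₃¹ + ((p+1)/2)φ_p^{p−1}f₃² = (k²+1)f₃²; (ii) the function m₃(x,k) := e^{x·√(2+k²)}·f₃(x,k) (principal square root) satisfies |m₃(x,k) − (0,1)| ≤ C(1+|k|)^{−1}e^{−γx} and |∂_x m₃(x,k)| ≤ C(1+|k|)^{−1}e^{−γx} for all x ≥ x₀. -/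

import Mathlib

/-- The ground state `φ_p` of the pure power NLS on the line. -/
noncomputable def groundState (p x : ℝ) : ℝ :=
  ((p + 1) / 2) ^ (1 / (p - 1)) * (1 / Real.cosh ((p - 1) * x / 2)) ^ (2 / (p - 1))

open MeasureTheory Set Filter Topology

/-! ### Integrals dominated by the derivative of a decreasing function -/

theorem integrableOn_Ioi_and_norm_integral_le_of_le_neg_deriv {f : ℝ → ℂ} {Φ φ : ℝ → ℝ}
    (hf : Continuous f) (hΦ : ∀ y, HasDerivAt Φ (-φ y) y) (hΦ0 : ∀ y, 0 ≤ Φ y)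
    (hle : ∀ y, ‖f y‖ ≤ φ y) (x : ℝ) :
    IntegrableOn f (Ioi x) ∧ ‖∫ y in Ioi x, f y‖ ≤ Φ x := by
  have hφ : ∀ y, 0 ≤ φ y := fun y => (norm_nonneg _).trans (hle y)
  have hanti : Antitone Φ := by
    refine antitone_of_deriv_nonpos (fun y => (hΦ y).differentiableAt) fun y => ?_
    rw [(hΦ y).deriv]
    linarith [hφ y]
  have hlim : Tendsto Φ atTop (𝓝 (⨅ y, Φ y)) :=
    tendsto_atTop_ciInf hanti ⟨0, by rintro _ ⟨y, rfl⟩; exact hΦ0 y⟩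
  have hint : IntegrableOn (fun y => -φ y) (Ioi x) :=
    integrableOn_Ioi_deriv_of_nonpos' (fun y _ => hΦ y) (fun y _ => by linarith [hφ y]) hlim
  have hval : ∫ y in Ioi x, -φ y = (⨅ y, Φ y) - Φ x :=
    integral_Ioi_of_hasDerivAt_of_nonpos' (fun y _ => hΦ y) (fun y _ => by linarith [hφ y]) hlim
  have hint' : IntegrableOn φ (Ioi x) := by simpa using hint.neg
  refine ⟨hint'.mono' hf.aestronglyMeasurable (ae_of_all _ hle), ?_⟩
  calc ‖∫ y in Ioi x, f y‖ ≤ ∫ y in Ioi x, φ y :=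
        norm_integral_le_of_norm_le hint' (ae_of_all _ hle)
    _ = Φ x - ⨅ y, Φ y := by rw [integral_neg] at hval; linarith
    _ ≤ Φ x := by linarith [Real.iInf_nonneg hΦ0]

theorem norm_intervalIntegral_le_of_le_neg_deriv {f : ℝ → ℂ} {Φ φ : ℝ → ℝ} {a b : ℝ}
    (hab : a ≤ b) (hφc : Continuous φ) (hΦ : ∀ y, HasDerivAt Φ (-φ y) y)
    (hle : ∀ y ∈ Ioc a b, ‖f y‖ ≤ φ y) : ‖∫ y in a..b, f y‖ ≤ Φ a - Φ b := by
  refine (intervalIntegral.norm_integral_le_of_norm_le hab (ae_of_all _ hle)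
    (hφc.intervalIntegrable _ _)).trans_eq ?_
  have h := intervalIntegral.integral_eq_sub_of_hasDerivAt (a := a) (b := b)
    (fun y _ => hΦ y) (hφc.neg.intervalIntegrable _ _)
  rw [intervalIntegral.integral_neg] at h
  linarith

/-! ### The weight -/

/-- The weight `e^{-γx + L e^{-εx}}`. -/
noncomputable def decayWeight (γ ε L x : ℝ) : ℝ := Real.exp (-γ * x + L * Real.exp (-ε * x))

theorem decayWeight_pos (γ ε L x : ℝ) : 0 < decayWeight γ ε L x := Real.exp_pos _

theorem continuous_decayWeight (γ ε L : ℝ) : Continuous (decayWeight γ ε L) := by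
  unfold decayWeight; fun_prop

theorem hasDerivAt_decayWeight (γ ε L x : ℝ) :
    HasDerivAt (decayWeight γ ε L)
      (-((γ + L * ε * Real.exp (-ε * x)) * decayWeight γ ε L x)) x := by
  have h1 : HasDerivAt (fun x : ℝ => -ε * x) (-ε) x := by
    simpa using (hasDerivAt_id x).const_mul (-ε)
  have h2 : HasDerivAt (fun x : ℝ => -γ * x) (-γ) x := by
    simpa using (hasDerivAt_id x).const_mul (-γ)
  refine HasDerivAt.congr_deriv (f' := _) (h2.add (h1.exp.const_mul L)).exp ?_
  simp only [decayWeight, Pi.add_apply]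
  ring

theorem exp_mul_decayWeight (s γ ε L x : ℝ) :
    Real.exp (-s * x) * decayWeight γ ε L x = decayWeight (s + γ) ε L x := by
  rw [decayWeight, decayWeight, ← Real.exp_add]
  ring_nf

theorem exp_le_decayWeight {γ ε L : ℝ} (hL : 0 ≤ L) (x : ℝ) :
    Real.exp (-γ * x) ≤ decayWeight γ ε L x := by
  rw [decayWeight, Real.exp_le_exp]
  linarith [mul_nonneg hL (Real.exp_pos (-ε * x)).le]

theorem decayWeight_le {γ ε L x₀ x : ℝ} (hε : 0 ≤ ε) (hL : 0 ≤ L) (hx : x₀ ≤ x) :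
    decayWeight γ ε L x ≤ decayWeight 0 ε L x₀ * Real.exp (-γ * x) := by
  rw [decayWeight, decayWeight, ← Real.exp_add, Real.exp_le_exp]
  have : Real.exp (-ε * x) ≤ Real.exp (-ε * x₀) := Real.exp_le_exp.2 (by nlinarith)
  nlinarith

theorem norm_cexp_neg_mul_ofReal (σ : ℂ) (y : ℝ) :
    ‖Complex.exp (-σ * y)‖ = Real.exp (-σ.re * y) := by
  rw [Complex.norm_exp]; simp

theorem norm_cexp_mul_ofReal (σ : ℂ) (y : ℝ) :
    ‖Complex.exp (σ * y)‖ = Real.exp (σ.re * y) := by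
  rw [Complex.norm_exp]; simp

/-! ### Right inverses of `d/dx - σ` -/

/-- The solution of `u' = σ u + g` obtained by integrating from `+∞`. -/
noncomputable def solveFromInfinity (σ : ℂ) (g : ℝ → ℂ) (x : ℝ) : ℂ :=
  -(Complex.exp (σ * x) * ∫ y in Ioi x, Complex.exp (-σ * y) * g y)

/-- The solution of `u' = σ u + g` vanishing at `x₁`. -/
noncomputable def solveFromPoint (x₁ : ℝ) (σ : ℂ) (g : ℝ → ℂ) (x : ℝ) : ℂ :=
  Complex.exp (σ * x) * ∫ y in x₁..x, Complex.exp (-σ * y) * g y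

theorem hasDerivAt_cexp_mul_primitive {σ : ℂ} {g : ℝ → ℂ} (hg : Continuous g) (c : ℂ)
    (a x : ℝ) :
    HasDerivAt (fun x : ℝ => Complex.exp (σ * x) *
        (c + ∫ y in a..x, Complex.exp (-σ * y) * g y))
      (σ * (Complex.exp (σ * x) * (c + ∫ y in a..x, Complex.exp (-σ * y) * g y)) + g x) x := by
  have hc : Continuous fun y : ℝ => Complex.exp (-σ * y) * g y := by fun_prop
  have h1 : HasDerivAt (fun x : ℝ => Complex.exp (σ * x)) (Complex.exp (σ * x) * σ) x := by
    have := ((hasDerivAt_id (x : ℂ)).const_mul σ).cexp.comp_ofReal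
    simpa using this
  have h2 := (intervalIntegral.integral_hasDerivAt_right (hc.intervalIntegrable a x)
    (hc.stronglyMeasurableAtFilter _ _) hc.continuousAt).const_add c
  refine (h1.mul h2).congr_deriv ?_
  have : Complex.exp (σ * x) * Complex.exp (-σ * x) = 1 := by
    rw [← Complex.exp_add]; simp
  linear_combination (g x) * this

/-- `S` inverts `d/dx - σ` linearly on continuous functions dominated by `ψ`, with values dominated
by `q • ω`. -/
structure IsWeightedInverse (σ : ℂ) (ψ ω : ℝ → ℝ) (q : ℝ) (S : (ℝ → ℂ) → ℝ → ℂ) : Prop where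
  hasDerivAt : ∀ g : ℝ → ℂ, Continuous g → ∀ K, 0 ≤ K → (∀ y, ‖g y‖ ≤ K * ψ y) →
    ∀ x, HasDerivAt (S g) (σ * S g x + g x) x
  bound : ∀ g : ℝ → ℂ, Continuous g → ∀ K, 0 ≤ K → (∀ y, ‖g y‖ ≤ K * ψ y) →
    ∀ x, ‖S g x‖ ≤ K * q * ω x
  sub : ∀ g h : ℝ → ℂ, Continuous g → Continuous h → ∀ K, 0 ≤ K →
    (∀ y, ‖g y‖ ≤ K * ψ y) → (∀ y, ‖h y‖ ≤ K * ψ y) → ∀ x, S (fun y => g y - h y) x = S g x - S h x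

theorem isWeightedInverse_solveFromInfinity {σ : ℂ} {γ ε L q : ℝ} {ψ : ℝ → ℝ} (_hε : 0 ≤ ε)
    (_hL : 0 ≤ L) (_hσ : 0 ≤ σ.re + γ) (hq : 0 ≤ q)
    (hψ : ∀ y, ψ y ≤ q * ((σ.re + γ + L * ε * Real.exp (-ε * y)) * decayWeight γ ε L y)) :
    IsWeightedInverse σ ψ (decayWeight γ ε L) q (solveFromInfinity σ) := by
  have key : ∀ g : ℝ → ℂ, Continuous g → ∀ K, 0 ≤ K → (∀ y, ‖g y‖ ≤ K * ψ y) → ∀ x,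
      IntegrableOn (fun y : ℝ => Complex.exp (-σ * y) * g y) (Ioi x) ∧
      ‖∫ y in Ioi x, Complex.exp (-σ * y) * g y‖ ≤ K * q * decayWeight (σ.re + γ) ε L x := by
    intro g hg K hK hgb x
    refine integrableOn_Ioi_and_norm_integral_le_of_le_neg_deriv
      (Φ := fun y => K * q * decayWeight (σ.re + γ) ε L y)
      (φ := fun y => K * q * ((σ.re + γ + L * ε * Real.exp (-ε * y)) *
        decayWeight (σ.re + γ) ε L y))
      (by fun_prop) (fun y => ?_) (fun y => ?_) (fun y => ?_) x
    · exact ((hasDerivAt_decayWeight (σ.re + γ) ε L y).const_mul (K * q)).congr_deriv (by ring)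
    · have := decayWeight_pos (σ.re + γ) ε L y
      positivity
    · rw [norm_mul, norm_cexp_neg_mul_ofReal, ← exp_mul_decayWeight]
      calc Real.exp (-σ.re * y) * ‖g y‖
          ≤ Real.exp (-σ.re * y) * (K * (q * ((σ.re + γ + L * ε * Real.exp (-ε * y)) *
              decayWeight γ ε L y))) := by
            gcongr
            exact (hgb y).trans (by gcongr; exact hψ y)
        _ = _ := by ring
  refine ⟨?_, ?_, ?_⟩
  · intro g hg K hK hgb x
    have h := hasDerivAt_cexp_mul_primitive (σ := σ) hg
      (-∫ y in Ioi (0 : ℝ), Complex.exp (-σ * y) * g y) 0 x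
    have heq : ∀ z, solveFromInfinity σ g z = Complex.exp (σ * z) *
        (-(∫ y in Ioi (0 : ℝ), Complex.exp (-σ * y) * g y) +
          ∫ y in (0 : ℝ)..z, Complex.exp (-σ * y) * g y) := by
      intro z
      rw [solveFromInfinity, ← intervalIntegral.integral_interval_add_Ioi
        (key g hg K hK hgb 0).1 (key g hg K hK hgb z).1]
      ring
    rw [funext heq]
    exact h
  · intro g hg K hK hgb x
    rw [solveFromInfinity, norm_neg, norm_mul, norm_cexp_mul_ofReal]
    calc Real.exp (σ.re * x) * ‖∫ y in Ioi x, Complex.exp (-σ * y) * g y‖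
        ≤ Real.exp (σ.re * x) * (K * q * decayWeight (σ.re + γ) ε L x) := by
          gcongr
          exact (key g hg K hK hgb x).2
      _ = K * q * (Real.exp (-(-σ.re) * x) * decayWeight (σ.re + γ) ε L x) := by ring_nf
      _ = _ := by rw [exp_mul_decayWeight]; ring_nf
  · intro g h hg hh K hK hgb hhb x
    simp only [solveFromInfinity, mul_sub]
    rw [integral_sub (key g hg K hK hgb x).1 (key h hh K hK hhb x).1]
    ring

theorem isWeightedInverse_solveFromPoint {σ : ℂ} {γ ε L x₁ : ℝ} (hε : 0 < ε) (hL : 0 < L)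
    (hσ : σ.re + γ ≤ 0) (hx₁ : -2 * (σ.re + γ) ≤ L * ε * Real.exp (-ε * x₁)) :
    IsWeightedInverse σ (fun y => Real.exp (-ε * y) * decayWeight γ ε L y) (decayWeight γ ε L)
      ((2 + decayWeight 0 ε L x₁) / (L * ε)) (solveFromPoint x₁ σ) := by
  refine ⟨?_, ?_, ?_⟩
  · intro g hg K hK hgb x
    have h := hasDerivAt_cexp_mul_primitive (σ := σ) hg 0 x₁ x
    simp only [zero_add] at h
    exact h
  · intro g hg K hK hgb x
    rw [solveFromPoint, norm_mul, norm_cexp_mul_ofReal]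
    have hD := decayWeight_pos 0 ε L x₁
    rcases le_total x₁ x with hx | hx
    · have hint : ‖∫ y in x₁..x, Complex.exp (-σ * y) * g y‖ ≤
          K / (L * ε) * Real.exp (-(σ.re + γ) * x) * decayWeight 0 ε L x₁ -
          K / (L * ε) * Real.exp (-(σ.re + γ) * x) * decayWeight 0 ε L x := by
        refine norm_intervalIntegral_le_of_le_neg_deriv
          (Φ := fun y => K / (L * ε) * Real.exp (-(σ.re + γ) * x) * decayWeight 0 ε L y)
          (φ := fun y => K / (L * ε) * Real.exp (-(σ.re + γ) * x) *
            ((0 + L * ε * Real.exp (-ε * y)) * decayWeight 0 ε L y)) hx ?_ (fun y => ?_)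
          (fun y hy => ?_)
        · have := continuous_decayWeight 0 ε L
          fun_prop
        · exact ((hasDerivAt_decayWeight 0 ε L y).const_mul
            (K / (L * ε) * Real.exp (-(σ.re + γ) * x))).congr_deriv (by ring)
        · rw [norm_mul, norm_cexp_neg_mul_ofReal]
          have hw := decayWeight_pos 0 ε L y
          calc Real.exp (-σ.re * y) * ‖g y‖
              ≤ Real.exp (-σ.re * y) * (K * (Real.exp (-ε * y) * decayWeight γ ε L y)) := by
                gcongr; exact hgb y
            _ = K * Real.exp (-ε * y) * (Real.exp (-σ.re * y) * decayWeight (γ + 0) ε L y) := by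
                rw [add_zero]; ring
            _ = K * Real.exp (-ε * y) * (Real.exp (-(σ.re + γ) * y) * decayWeight 0 ε L y) := by
                rw [exp_mul_decayWeight, exp_mul_decayWeight]; ring_nf
            _ ≤ K * Real.exp (-ε * y) * (Real.exp (-(σ.re + γ) * x) * decayWeight 0 ε L y) := by
                gcongr K * _ * (Real.exp ?_ * _)
                nlinarith [hy.2]
            _ = _ := by field_simp; ring
      have hw := decayWeight_pos 0 ε L x
      calc Real.exp (σ.re * x) * ‖∫ y in x₁..x, Complex.exp (-σ * y) * g y‖
          ≤ Real.exp (σ.re * x) *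
            (K / (L * ε) * Real.exp (-(σ.re + γ) * x) * decayWeight 0 ε L x₁) := by
            gcongr
            refine hint.trans (sub_le_self _ ?_)
            positivity
        _ = K / (L * ε) * decayWeight 0 ε L x₁ * Real.exp (-γ * x) := by
            have : Real.exp (-γ * x) = Real.exp (σ.re * x) * Real.exp (-(σ.re + γ) * x) := by
              rw [← Real.exp_add]; ring_nf
            rw [this]; ring
        _ ≤ K / (L * ε) * (2 + decayWeight 0 ε L x₁) * decayWeight γ ε L x := by
            gcongr
            · linarith
            · exact exp_le_decayWeight hL.le x
        _ = _ := by ring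
    · have hint : ‖∫ y in x..x₁, Complex.exp (-σ * y) * g y‖ ≤
          2 * K / (L * ε) * decayWeight (σ.re + γ) ε L x -
          2 * K / (L * ε) * decayWeight (σ.re + γ) ε L x₁ := by
        refine norm_intervalIntegral_le_of_le_neg_deriv
          (Φ := fun y => 2 * K / (L * ε) * decayWeight (σ.re + γ) ε L y)
          (φ := fun y => 2 * K / (L * ε) *
            ((σ.re + γ + L * ε * Real.exp (-ε * y)) * decayWeight (σ.re + γ) ε L y)) hx ?_
          (fun y => ?_) (fun y hy => ?_)
        · have := continuous_decayWeight (σ.re + γ) ε L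
          fun_prop
        · exact ((hasDerivAt_decayWeight (σ.re + γ) ε L y).const_mul (2 * K / (L * ε))).congr_deriv (by ring)
        · rw [norm_mul, norm_cexp_neg_mul_ofReal]
          have hw := decayWeight_pos (σ.re + γ) ε L y
          have hexp : Real.exp (-ε * x₁) ≤ Real.exp (-ε * y) :=
            Real.exp_le_exp.2 (by nlinarith [hy.2])
          have hexp' : L * ε * Real.exp (-ε * x₁) ≤ L * ε * Real.exp (-ε * y) := by gcongr
          calc Real.exp (-σ.re * y) * ‖g y‖
              ≤ Real.exp (-σ.re * y) * (K * (Real.exp (-ε * y) * decayWeight γ ε L y)) := by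
                gcongr; exact hgb y
            _ = K * Real.exp (-ε * y) * (Real.exp (-σ.re * y) * decayWeight γ ε L y) := by ring
            _ = 2 * K / (L * ε) * ((L * ε * Real.exp (-ε * y) / 2) *
                  decayWeight (σ.re + γ) ε L y) := by
                rw [exp_mul_decayWeight]; field_simp
            _ ≤ _ := by
                gcongr
                linarith
      have hw := decayWeight_pos (σ.re + γ) ε L x₁
      have hw' := decayWeight_pos γ ε L x
      rw [intervalIntegral.integral_symm, norm_neg]
      calc Real.exp (σ.re * x) * ‖∫ y in x..x₁, Complex.exp (-σ * y) * g y‖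
          ≤ Real.exp (σ.re * x) * (2 * K / (L * ε) * decayWeight (σ.re + γ) ε L x) := by
            gcongr
            refine hint.trans (sub_le_self _ ?_)
            positivity
        _ = 2 * K / (L * ε) * (Real.exp (-(-σ.re) * x) * decayWeight (σ.re + γ) ε L x) := by
            ring_nf
        _ = K / (L * ε) * 2 * decayWeight γ ε L x := by rw [exp_mul_decayWeight]; ring_nf
        _ ≤ K / (L * ε) * (2 + decayWeight 0 ε L x₁) * decayWeight γ ε L x := by
            gcongr
            linarith
        _ = _ := by ring
  · intro g h hg hh K hK hgb hhb x
    simp only [solveFromPoint, mul_sub]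
    rw [intervalIntegral.integral_sub, mul_sub]
    · exact Continuous.intervalIntegrable (by fun_prop) _ _
    · exact Continuous.intervalIntegrable (by fun_prop) _ _

/-! ### Fixed points in weighted spaces of continuous functions -/

theorem exists_weighted_fixedPoint {E : Type*} [NormedAddCommGroup E] [NormedSpace ℝ E]
    [CompleteSpace E] {ω : ℝ → ℝ} (hω : Continuous ω) (hpos : ∀ x, 0 < ω x)
    {Φ : (ℝ → E) → ℝ → E} {H : ℝ}
    (hc : ∀ a, Continuous a → ∀ K, 0 ≤ K → (∀ x, ‖a x‖ ≤ K * ω x) → Continuous (Φ a))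
    (h0 : ∀ x, ‖Φ (fun _ => 0) x‖ ≤ H * ω x)
    (hlip : ∀ a b, Continuous a → Continuous b → ∀ K, 0 ≤ K → (∀ x, ‖a x‖ ≤ K * ω x) →
      (∀ x, ‖b x‖ ≤ K * ω x) → ∀ M, 0 ≤ M → (∀ x, ‖a x - b x‖ ≤ M * ω x) →
      ∀ x, ‖Φ a x - Φ b x‖ ≤ M / 2 * ω x) :
    ∃ a, Continuous a ∧ (∀ x, ‖a x‖ ≤ 2 * H * ω x) ∧ Φ a = a := by
  have hne : ∀ x, ω x ≠ 0 := fun x => (hpos x).ne'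
  have hlc : ∀ v : BoundedContinuousFunction ℝ E, Continuous fun y => ω y • v y :=
    fun v => hω.smul v.continuous
  have hlb : ∀ (v : BoundedContinuousFunction ℝ E) (x : ℝ), ‖ω x • v x‖ ≤ ‖v‖ * ω x := by
    intro v x
    rw [norm_smul, Real.norm_of_nonneg (hpos x).le, mul_comm]
    exact mul_le_mul_of_nonneg_right (v.norm_coe_le_norm x) (hpos x).le
  have hdiff : ∀ (v w : BoundedContinuousFunction ℝ E) (x : ℝ),
      ‖Φ (fun y => ω y • v y) x - Φ (fun y => ω y • w y) x‖ ≤ ‖v - w‖ / 2 * ω x := by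
    intro v w x
    refine hlip _ _ (hlc v) (hlc w) (max ‖v‖ ‖w‖) (le_max_of_le_left (norm_nonneg v))
      (fun x => (hlb v x).trans ?_) (fun x => (hlb w x).trans ?_) ‖v - w‖ (norm_nonneg _)
      (fun x => ?_) x
    · exact mul_le_mul_of_nonneg_right (le_max_left _ _) (hpos x).le
    · exact mul_le_mul_of_nonneg_right (le_max_right _ _) (hpos x).le
    · rw [← smul_sub]
      exact hlb (v - w) x
  have hbd : ∀ (v : BoundedContinuousFunction ℝ E) (x : ℝ),
      ‖Φ (fun y => ω y • v y) x‖ ≤ (‖v‖ / 2 + H) * ω x := by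
    intro v x
    have h1 := hdiff v 0 x
    have h2 := h0 x
    simp only [BoundedContinuousFunction.coe_zero, Pi.zero_apply, smul_zero, sub_zero] at h1
    have h3 := norm_add_le (Φ (fun y => ω y • v y) x - Φ (fun _ => 0) x) (Φ (fun _ => 0) x)
    rw [sub_add_cancel] at h3
    linarith
  have hinv : ∀ (z : E) (x K : ℝ), ‖z‖ ≤ K * ω x → ‖(ω x)⁻¹ • z‖ ≤ K := by
    intro z x K hz
    rw [norm_smul, norm_inv, Real.norm_of_nonneg (hpos x).le, inv_mul_le_iff₀ (hpos x), mul_comm]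
    exact hz
  let F : BoundedContinuousFunction ℝ E → BoundedContinuousFunction ℝ E := fun v =>
    BoundedContinuousFunction.ofNormedAddCommGroup
      (fun x => (ω x)⁻¹ • Φ (fun y => ω y • v y) x)
      ((hω.inv₀ hne).smul (hc _ (hlc v) ‖v‖ (norm_nonneg v) (hlb v))) (‖v‖ / 2 + H)
      (fun x => hinv _ _ _ (hbd v x))
  have hF : ContractingWith (1 / 2) F := by
    refine ⟨by rw [← NNReal.coe_lt_coe]; norm_num, LipschitzWith.of_dist_le_mul fun v w => ?_⟩
    rw [BoundedContinuousFunction.dist_le (by positivity)]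
    intro x
    rw [dist_eq_norm, dist_eq_norm]
    change ‖(ω x)⁻¹ • Φ (fun y => ω y • v y) x - (ω x)⁻¹ • Φ (fun y => ω y • w y) x‖ ≤ _
    rw [← smul_sub]
    refine hinv _ _ _ ((hdiff v w x).trans_eq ?_)
    push_cast
    ring
  obtain ⟨v, hv⟩ : ∃ v, F v = v := ⟨_, hF.fixedPoint_isFixedPt⟩
  have hfix : Φ (fun y => ω y • v y) = fun y => ω y • v y := by
    funext x
    have : (ω x)⁻¹ • Φ (fun y => ω y • v y) x = v x := DFunLike.congr_fun hv x
    rw [← this, smul_inv_smul₀ (hne x)]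
  have hvH : ‖v‖ ≤ ‖v‖ / 2 + H := by
    have hnn : 0 ≤ ‖v‖ / 2 + H := by
      have := (norm_nonneg _).trans (hbd v 0)
      exact nonneg_of_mul_nonneg_left this (hpos 0)
    refine (BoundedContinuousFunction.norm_le hnn).2 fun x => ?_
    have hvx : (ω x)⁻¹ • Φ (fun y => ω y • v y) x = v x := DFunLike.congr_fun hv x
    rw [← hvx]
    exact hinv _ _ _ (hbd v x)
  refine ⟨_, hlc v, fun x => (hlb v x).trans ?_, hfix⟩
  exact mul_le_mul_of_nonneg_right (by linarith) (hpos x).le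

/-! ### The integral system for the Jost solution -/

/-- The right-hand side `-(A n₁ + B (1 + n₂))`. -/
def jostForcing (A B : ℝ → ℝ) (n₁ n₂ : ℝ → ℂ) (y : ℝ) : ℂ :=
  -((A y : ℂ) * n₁ y + (B y : ℂ) * (1 + n₂ y))

theorem continuous_jostForcing {A B : ℝ → ℝ} {n₁ n₂ : ℝ → ℂ} (hA : Continuous A)
    (hB : Continuous B) (h₁ : Continuous n₁) (h₂ : Continuous n₂) :
    Continuous (jostForcing A B n₁ n₂) := by
  unfold jostForcing; fun_prop

theorem norm_jostForcing_le {A B ψ ω : ℝ → ℝ} {n₁ n₂ : ℝ → ℂ} {w N : ℝ} {y : ℝ} (hA : 0 ≤ A y)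
    (hB : 0 ≤ B y) (hψ : A y + B y ≤ w * ψ y) (hψω : (A y + B y) * ω y ≤ w * ψ y) (hN : 0 ≤ N)
    (h₁ : ‖n₁ y‖ ≤ N * ω y) (h₂ : ‖n₂ y‖ ≤ N * ω y) :
    ‖jostForcing A B n₁ n₂ y‖ ≤ w * (1 + N) * ψ y := by
  rw [jostForcing, norm_neg]
  have h3 : ‖1 + n₂ y‖ ≤ 1 + N * ω y := by
    refine (norm_add_le _ _).trans ?_
    rw [norm_one]
    linarith
  calc ‖(A y : ℂ) * n₁ y + (B y : ℂ) * (1 + n₂ y)‖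
      ≤ A y * ‖n₁ y‖ + B y * ‖1 + n₂ y‖ := by
        refine (norm_add_le _ _).trans_eq ?_
        rw [norm_mul, norm_mul, Complex.norm_of_nonneg hA, Complex.norm_of_nonneg hB]
    _ ≤ A y * (1 + N * ω y) + B y * (1 + N * ω y) := by
        gcongr
        linarith
    _ = (A y + B y) + N * ((A y + B y) * ω y) := by ring
    _ ≤ w * ψ y + N * (w * ψ y) := by gcongr
    _ = _ := by ring

theorem norm_jostForcing_sub_le {A B ψ ω : ℝ → ℝ} {n₁ n₂ m₁ m₂ : ℝ → ℂ} {w N : ℝ} {y : ℝ}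
    (hA : 0 ≤ A y) (hB : 0 ≤ B y) (hψω : (A y + B y) * ω y ≤ w * ψ y) (hN : 0 ≤ N)
    (h₁ : ‖n₁ y - m₁ y‖ ≤ N * ω y) (h₂ : ‖n₂ y - m₂ y‖ ≤ N * ω y) :
    ‖jostForcing A B n₁ n₂ y - jostForcing A B m₁ m₂ y‖ ≤ w * N * ψ y := by
  have heq : jostForcing A B n₁ n₂ y - jostForcing A B m₁ m₂ y =
      -((A y : ℂ) * (n₁ y - m₁ y) + (B y : ℂ) * (n₂ y - m₂ y)) := by
    simp only [jostForcing]; ring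
  rw [heq, norm_neg]
  calc ‖(A y : ℂ) * (n₁ y - m₁ y) + (B y : ℂ) * (n₂ y - m₂ y)‖
      ≤ A y * ‖n₁ y - m₁ y‖ + B y * ‖n₂ y - m₂ y‖ := by
        refine (norm_add_le _ _).trans_eq ?_
        rw [norm_mul, norm_mul, Complex.norm_of_nonneg hA, Complex.norm_of_nonneg hB]
    _ ≤ A y * (N * ω y) + B y * (N * ω y) := by gcongr
    _ = N * ((A y + B y) * ω y) := by ring
    _ ≤ N * (w * ψ y) := by gcongr
    _ = _ := by ring

namespace IsWeightedInverse

variable {σ : ℂ} {ψ ω : ℝ → ℝ} {q : ℝ} {S : (ℝ → ℂ) → ℝ → ℂ}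

theorem mono (h : IsWeightedInverse σ ψ ω q S) {q' : ℝ} (hω : ∀ x, 0 ≤ ω x) (hq : q ≤ q') :
    IsWeightedInverse σ ψ ω q' S where
  hasDerivAt := h.hasDerivAt
  bound g hg K hK hgb x := (h.bound g hg K hK hgb x).trans
    (mul_le_mul_of_nonneg_right (mul_le_mul_of_nonneg_left hq hK) (hω x))
  sub := h.sub

theorem continuous (h : IsWeightedInverse σ ψ ω q S) {g : ℝ → ℂ} (hg : Continuous g) {K : ℝ}
    (hK : 0 ≤ K) (hgb : ∀ y, ‖g y‖ ≤ K * ψ y) : Continuous (S g) :=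
  continuous_iff_continuousAt.2 fun x => (h.hasDerivAt g hg K hK hgb x).continuousAt

theorem norm_sub_le (h : IsWeightedInverse σ ψ ω q S) {g g' : ℝ → ℂ} (hg : Continuous g)
    (hg' : Continuous g') {K : ℝ} (hK : 0 ≤ K) (hgb : ∀ y, ‖g y‖ ≤ K * ψ y)
    (hgb' : ∀ y, ‖g' y‖ ≤ K * ψ y) {M : ℝ} (hM : 0 ≤ M)
    (hgg' : ∀ y, ‖g y - g' y‖ ≤ M * ψ y) (x : ℝ) : ‖S g x - S g' x‖ ≤ M * q * ω x := by
  rw [← h.sub g g' hg hg' K hK hgb hgb' x]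
  exact h.bound _ (hg.sub hg') M hM hgg' x

end IsWeightedInverse

theorem exists_solution_integral_system {A B ψ ω : ℝ → ℝ} {w q r : ℝ} {σ₁ σ₂ ρ₁ ρ₂ : ℂ}
    {S₁ S₂ R₁ R₂ : (ℝ → ℂ) → ℝ → ℂ} (hA : Continuous A) (hB : Continuous B) (hω : Continuous ω)
    (hpos : ∀ x, 0 < ω x) (hA0 : ∀ y, 0 ≤ A y) (hB0 : ∀ y, 0 ≤ B y) (hw : 0 ≤ w)
    (hr : 0 ≤ r)
    (hψ : ∀ y, A y + B y ≤ w * ψ y) (hψω : ∀ y, (A y + B y) * ω y ≤ w * ψ y)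
    (hS₁ : IsWeightedInverse σ₁ ψ ω q S₁) (hS₂ : IsWeightedInverse σ₂ ψ ω q S₂)
    (hR₁ : IsWeightedInverse ρ₁ ω ω r R₁) (hR₂ : IsWeightedInverse ρ₂ ω ω r R₂)
    (hsmall : w * r * q ≤ 1 / 2) :
    ∃ a₁ a₂ : ℝ → ℂ, Continuous a₁ ∧ Continuous a₂ ∧
      (∀ x, ‖a₁ x‖ ≤ 2 * (w * q) * ω x) ∧ (∀ x, ‖a₂ x‖ ≤ 2 * (w * q) * ω x) ∧
      S₁ (jostForcing A B (R₁ a₁) (R₂ a₂)) = a₁ ∧ S₂ (jostForcing B A (R₁ a₁) (R₂ a₂)) = a₂ := by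
  have hψ' : ∀ y, B y + A y ≤ w * ψ y := fun y => by rw [add_comm]; exact hψ y
  have hψω' : ∀ y, (B y + A y) * ω y ≤ w * ψ y := fun y => by rw [add_comm]; exact hψω y
  have hR0 : ∀ {ρ R}, IsWeightedInverse ρ ω ω r R → ∀ x, R (fun _ => 0) x = 0 := by
    intro ρ R hR x
    have := hR.bound (fun _ => 0) continuous_const 0 le_rfl (by simp) x
    simpa using this
  obtain ⟨a, hac, hab, hfix⟩ := exists_weighted_fixedPoint (E := ℂ × ℂ) hω hpos
    (H := w * q)
    (Φ := fun a x =>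
      (S₁ (jostForcing A B (R₁ fun y => (a y).1) (R₂ fun y => (a y).2)) x,
        S₂ (jostForcing B A (R₁ fun y => (a y).1) (R₂ fun y => (a y).2)) x))
    (by
      intro a ha K hK hab
      have hb₁ : ∀ y, ‖(a y).1‖ ≤ K * ω y := fun y => (norm_fst_le _).trans (hab y)
      have hb₂ : ∀ y, ‖(a y).2‖ ≤ K * ω y := fun y => (norm_snd_le _).trans (hab y)
      have hc₁ := hR₁.continuous ha.fst hK hb₁
      have hc₂ := hR₂.continuous ha.snd hK hb₂
      have hn₁ := hR₁.bound _ ha.fst K hK hb₁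
      have hn₂ := hR₂.bound _ ha.snd K hK hb₂
      exact (hS₁.continuous (K := w * (1 + K * r)) (continuous_jostForcing hA hB hc₁ hc₂)
          (by positivity) fun y => norm_jostForcing_le (hA0 y) (hB0 y) (hψ y) (hψω y)
            (by positivity) (hn₁ y) (hn₂ y)).prodMk
        (hS₂.continuous (K := w * (1 + K * r)) (continuous_jostForcing hB hA hc₁ hc₂)
          (by positivity) fun y => norm_jostForcing_le (hB0 y) (hA0 y) (hψ' y) (hψω' y)
            (by positivity) (hn₁ y) (hn₂ y)))
    (by
      intro x
      have hz₁ : R₁ (fun _ => 0) = fun _ => 0 := funext (hR0 hR₁)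
      have hz₂ : R₂ (fun _ => 0) = fun _ => 0 := funext (hR0 hR₂)
      simp only [Prod.fst_zero, Prod.snd_zero, hz₁, hz₂]
      have hcz : Continuous fun _ : ℝ => (0 : ℂ) := continuous_const
      refine norm_prod_le_iff.2 ⟨?_, ?_⟩
      · refine hS₁.bound _ (continuous_jostForcing hA hB hcz hcz) w hw (fun y => ?_) x
        simpa using norm_jostForcing_le (n₁ := fun _ => 0) (n₂ := fun _ => 0) (N := 0)
          (hA0 y) (hB0 y) (hψ y) (hψω y) le_rfl (by simp) (by simp)
      · refine hS₂.bound _ (continuous_jostForcing hB hA hcz hcz) w hw (fun y => ?_) x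
        simpa using norm_jostForcing_le (n₁ := fun _ => 0) (n₂ := fun _ => 0) (N := 0)
          (hB0 y) (hA0 y) (hψ' y) (hψω' y) le_rfl (by simp) (by simp))
    (by
      intro a b ha hb K hK hab hbb M hM hM' x
      have ha₁ : ∀ y, ‖(a y).1‖ ≤ K * ω y := fun y => (norm_fst_le _).trans (hab y)
      have ha₂ : ∀ y, ‖(a y).2‖ ≤ K * ω y := fun y => (norm_snd_le _).trans (hab y)
      have hb₁ : ∀ y, ‖(b y).1‖ ≤ K * ω y := fun y => (norm_fst_le _).trans (hbb y)
      have hb₂ : ∀ y, ‖(b y).2‖ ≤ K * ω y := fun y => (norm_snd_le _).trans (hbb y)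
      have hac₁ := hR₁.continuous ha.fst hK ha₁
      have hac₂ := hR₂.continuous ha.snd hK ha₂
      have hbc₁ := hR₁.continuous hb.fst hK hb₁
      have hbc₂ := hR₂.continuous hb.snd hK hb₂
      have han₁ := hR₁.bound _ ha.fst K hK ha₁
      have han₂ := hR₂.bound _ ha.snd K hK ha₂
      have hbn₁ := hR₁.bound _ hb.fst K hK hb₁
      have hbn₂ := hR₂.bound _ hb.snd K hK hb₂
      have hd₁ := hR₁.norm_sub_le ha.fst hb.fst hK ha₁ hb₁ hM
        fun y => (norm_fst_le (a y - b y)).trans (hM' y)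
      have hd₂ := hR₂.norm_sub_le ha.snd hb.snd hK ha₂ hb₂ hM
        fun y => (norm_snd_le (a y - b y)).trans (hM' y)
      have hfin : w * (M * r) * q * ω x ≤ M / 2 * ω x := by
        refine mul_le_mul_of_nonneg_right ?_ (hpos x).le
        calc w * (M * r) * q = M * (w * r * q) := by ring
          _ ≤ M * (1 / 2) := by gcongr
          _ = M / 2 := by ring
      refine norm_prod_le_iff.2 ⟨?_, ?_⟩
      · refine (hS₁.norm_sub_le (K := w * (1 + K * r)) (M := w * (M * r))
          (continuous_jostForcing hA hB hac₁ hac₂) (continuous_jostForcing hA hB hbc₁ hbc₂)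
          (by positivity) (fun y => ?_) (fun y => ?_) (by positivity) (fun y => ?_) x).trans hfin
        · exact norm_jostForcing_le (hA0 y) (hB0 y) (hψ y) (hψω y) (by positivity)
            (han₁ y) (han₂ y)
        · exact norm_jostForcing_le (hA0 y) (hB0 y) (hψ y) (hψω y) (by positivity)
            (hbn₁ y) (hbn₂ y)
        · exact norm_jostForcing_sub_le (hA0 y) (hB0 y) (hψω y) (by positivity)
            (hd₁ y) (hd₂ y)
      · refine (hS₂.norm_sub_le (K := w * (1 + K * r)) (M := w * (M * r))
          (continuous_jostForcing hB hA hac₁ hac₂) (continuous_jostForcing hB hA hbc₁ hbc₂)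
          (by positivity) (fun y => ?_) (fun y => ?_) (by positivity) (fun y => ?_) x).trans hfin
        · exact norm_jostForcing_le (hB0 y) (hA0 y) (hψ' y) (hψω' y) (by positivity)
            (han₁ y) (han₂ y)
        · exact norm_jostForcing_le (hB0 y) (hA0 y) (hψ' y) (hψω' y) (by positivity)
            (hbn₁ y) (hbn₂ y)
        · exact norm_jostForcing_sub_le (hB0 y) (hA0 y) (hψω' y) (by positivity)
            (hd₁ y) (hd₂ y))
  refine ⟨fun y => (a y).1, fun y => (a y).2, hac.fst, hac.snd,
    fun y => (norm_fst_le _).trans (hab y), fun y => (norm_snd_le _).trans (hab y),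
    funext fun y => ?_, funext fun y => ?_⟩
  · exact congrArg Prod.fst (congrFun hfix y)
  · exact congrArg Prod.snd (congrFun hfix y)

/-! ### Jost solutions, uniformly in the spectral parameter -/

theorem jost_exponent_bounds {k μ : ℂ} (hμ : μ ^ 2 = 2 + k ^ 2) (hre : 0 ≤ μ.re)
    (hk₁ : -Real.sqrt 2 ≤ k.im) (hk₂ : k.im ≤ 1) :
    k.im ≤ μ.re ∧ ‖k‖ - 3 ≤ μ.re - k.im ∧ ‖k‖ - 3 ≤ μ.re + k.im ∧ ‖k‖ - 3 ≤ 2 * μ.re ∧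
      -(3 / 2) ≤ k.im ∧ ‖μ‖ ≤ 2 + ‖k‖ := by
  have hsq : Real.sqrt 2 ^ 2 = 2 := Real.sq_sqrt (by norm_num)
  have hs : Real.sqrt 2 ≤ 3 / 2 := by
    rw [Real.sqrt_le_left (by norm_num)]; norm_num
  have hs1 : 1 ≤ Real.sqrt 2 := by rw [Real.one_le_sqrt]; norm_num
  have him : |k.im| ≤ Real.sqrt 2 := abs_le.2 ⟨hk₁, hk₂.trans hs1⟩
  have him2 : k.im ^ 2 ≤ 2 := by rw [← sq_abs, ← hsq]; gcongr
  have hre2 : μ.re ^ 2 - μ.im ^ 2 = 2 + k.re ^ 2 - k.im ^ 2 := by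
    have := congrArg Complex.re hμ
    simp [pow_two] at this
    linarith
  have ha : |k.re| ≤ μ.re := by
    refine abs_le_of_sq_le_sq ?_ hre
    nlinarith [sq_nonneg μ.im]
  have hb : k.im ≤ μ.re := by
    rcases le_total k.im 0 with h | h
    · exact h.trans hre
    · refine abs_le_of_sq_le_sq' ?_ hre |>.2
      nlinarith [sq_nonneg μ.im, sq_nonneg k.re]
  have hnorm := Complex.norm_le_abs_re_add_abs_im k
  have h1 := neg_abs_le k.im
  have h2 := le_abs_self k.im
  have h3 := abs_nonneg k.re
  refine ⟨hb, by linarith, by linarith, by linarith, by linarith, ?_⟩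
  have hn : ‖μ‖ ^ 2 ≤ 2 + ‖k‖ ^ 2 := by
    rw [← norm_pow, hμ]
    refine (norm_add_le _ _).trans_eq ?_
    rw [norm_pow]; norm_num
  nlinarith [norm_nonneg μ, norm_nonneg k]

theorem one_div_add_le_of_norm_sub_le {γ s t : ℝ} (hγ : 0 < γ) (ht : 7 ≤ t) (hs : t - 3 ≤ s) :
    1 / (γ + s) ≤ 2 * (1 + t)⁻¹ := by
  rw [← div_eq_mul_inv, div_le_div_iff₀ (by linarith) (by linarith)]
  linarith

/-- Existence of a solution of the system for `(n₁, n₂) = m₃ - (0, 1)` in terms of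
`a₁ = n₁' - (μ + ik) n₁` and `a₂ = n₂'`. -/
theorem exists_jost_system {A B : ℝ → ℝ} {γ ε w : ℝ} (hA : Continuous A) (hB : Continuous B)
    (hA0 : ∀ y, 0 ≤ A y) (hB0 : ∀ y, 0 ≤ B y) (hγ : 0 < γ) (hε : 0 < ε) (hw : 0 ≤ w)
    (hAB : ∀ s, 0 ≤ s → s ≤ γ + ε → ∀ y, A y + B y ≤ w * Real.exp (-s * y)) :
    ∃ C > 0, ∃ L > 0, ∀ k μ : ℂ, μ ^ 2 = 2 + k ^ 2 → 0 ≤ μ.re → -Real.sqrt 2 ≤ k.im →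
      k.im ≤ 1 → ∃ n₁ n₂ a₁ a₂ : ℝ → ℂ,
        (∀ x, HasDerivAt n₁ ((μ + Complex.I * k) * n₁ x + a₁ x) x) ∧
        (∀ x, HasDerivAt n₂ (a₂ x) x) ∧
        (∀ x, HasDerivAt a₁ ((μ - Complex.I * k) * a₁ x + jostForcing A B n₁ n₂ x) x) ∧
        (∀ x, HasDerivAt a₂ (2 * μ * a₂ x + jostForcing B A n₁ n₂ x) x) ∧
        (∀ x, ‖n₁ x‖ ≤ C * (1 + ‖k‖)⁻¹ * decayWeight γ ε L x) ∧
        (∀ x, ‖n₂ x‖ ≤ C * (1 + ‖k‖)⁻¹ * decayWeight γ ε L x) ∧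
        (∀ x, ‖(μ + Complex.I * k) * n₁ x + a₁ x‖ ≤ C * (1 + ‖k‖)⁻¹ * decayWeight γ ε L x) ∧
        (∀ x, ‖a₂ x‖ ≤ C * (1 + ‖k‖)⁻¹ * decayWeight γ ε L x) := by
  set D := 2 + Real.exp (3 / ε) with hD
  have hDpos : 0 < D := by positivity
  obtain ⟨L, hL, hLs⟩ : ∃ L > 0, w * (1 / γ) * (D / (L * ε)) ≤ 1 / 2 := by
    refine ⟨2 * (w + 1) * D / (γ * ε), by positivity, ?_⟩
    have : w * (1 / γ) * (D / (2 * (w + 1) * D / (γ * ε) * ε)) = w / (w + 1) * (1 / 2) := by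
      field_simp
    rw [this]
    have h1 : w / (w + 1) ≤ 1 := by rw [div_le_one (by positivity)]; linarith
    linarith
  have hAB' : ∀ s, 0 ≤ s → s ≤ γ + ε → ∀ y, B y + A y ≤ w * Real.exp (-s * y) := by
    intro s hs hs' y; rw [add_comm]; exact hAB s hs hs' y
  set ω := decayWeight γ ε L with hω
  set ψ : ℝ → ℝ := fun y => Real.exp (-ε * y) * ω y with hψdef
  have hωpos : ∀ x, 0 < ω x := decayWeight_pos γ ε L
  have hexpω : ∀ x, Real.exp (-γ * x) ≤ ω x := exp_le_decayWeight hL.le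
  have hψ₁ : ∀ A B : ℝ → ℝ,
      (∀ s, 0 ≤ s → s ≤ γ + ε → ∀ y, A y + B y ≤ w * Real.exp (-s * y)) →
      (∀ y, A y + B y ≤ w * ψ y) ∧ (∀ y, (A y + B y) * ω y ≤ w * ψ y) ∧
      (∀ y, A y + B y ≤ w * ω y) ∧ (∀ y, (A y + B y) * ω y ≤ w * ω y) := by
    intro A B hAB
    refine ⟨fun y => ?_, fun y => ?_, fun y => ?_, fun y => ?_⟩
    · refine (hAB (γ + ε) (by positivity) le_rfl y).trans ?_
      have : Real.exp (-(γ + ε) * y) = Real.exp (-ε * y) * Real.exp (-γ * y) := by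
        rw [← Real.exp_add]; ring_nf
      rw [this]
      exact mul_le_mul_of_nonneg_left
        (mul_le_mul_of_nonneg_left (hexpω y) (Real.exp_pos _).le) hw
    · calc (A y + B y) * ω y ≤ w * Real.exp (-ε * y) * ω y :=
            mul_le_mul_of_nonneg_right (hAB ε hε.le (by linarith) y) (hωpos y).le
        _ = w * ψ y := by rw [hψdef]; ring
    · exact (hAB γ hγ.le (by linarith) y).trans (by gcongr; exact hexpω y)
    · refine mul_le_mul_of_nonneg_right ?_ (hωpos y).le
      simpa using hAB 0 le_rfl (by positivity) y
  obtain ⟨hψ, hψω, hω₁, hωω⟩ := hψ₁ A B hAB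
  obtain ⟨hψ', hψω', hω₁', hωω'⟩ := hψ₁ B A hAB'
  set q := D / (L * ε) with hq
  have hqpos : 0 < q := by positivity
  set Q := 2 * (w * q) with hQ
  set P := 8 * Q + w * (1 + Q * (1 / γ)) * 2 + 1 with hP
  have hQ0 : 0 ≤ Q := by positivity
  have hPpos : 0 < P := by positivity
  refine ⟨P * (5 + 17 / γ), by positivity, L, hL, ?_⟩
  intro k μ hμ hre hk₁ hk₂
  obtain ⟨hkμ, hm₁, hm₂, hm₃, hk₃, hμn⟩ := jost_exponent_bounds hμ hre hk₁ hk₂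
  set t := ‖k‖ with ht
  have ht0 : 0 ≤ t := norm_nonneg k
  have hre₁ : (μ + Complex.I * k).re = μ.re - k.im := by simp; ring
  have hre₂ : (μ - Complex.I * k).re = μ.re + k.im := by simp
  have hre₃ : (2 * μ).re = 2 * μ.re := by simp
  have hR : ∀ ρ : ℂ, 0 ≤ ρ.re →
      IsWeightedInverse ρ ω ω (1 / (γ + ρ.re)) (solveFromInfinity ρ) := by
    intro ρ hρ
    refine isWeightedInverse_solveFromInfinity hε.le hL.le (by linarith) (by positivity)
      fun y => ?_
    rw [← mul_assoc]
    refine le_mul_of_one_le_left (hωpos y).le ?_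
    rw [one_div, ← div_eq_inv_mul, one_le_div (by positivity)]
    have : 0 ≤ L * ε * Real.exp (-ε * y) := by positivity
    linarith
  have hRγ : ∀ ρ : ℂ, 0 ≤ ρ.re →
      IsWeightedInverse ρ ω ω (1 / γ) (solveFromInfinity ρ) := fun ρ hρ =>
    (hR ρ hρ).mono (fun x => (hωpos x).le) (one_div_le_one_div_of_le hγ (by linarith))
  have hSinf : ∀ σ : ℂ, 0 ≤ σ.re + γ →
      IsWeightedInverse σ ψ ω q (solveFromInfinity σ) := by
    intro σ hσ
    refine isWeightedInverse_solveFromInfinity hε.le hL.le hσ hqpos.le fun y => ?_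
    rw [hψdef, ← mul_assoc]
    refine mul_le_mul_of_nonneg_right ?_ (hωpos y).le
    have hD1 : 1 ≤ D := by rw [hD]; linarith [Real.exp_pos (3 / ε)]
    calc Real.exp (-ε * y) = 1 / (L * ε) * (L * ε * Real.exp (-ε * y)) := by field_simp
      _ ≤ q * (σ.re + γ + L * ε * Real.exp (-ε * y)) := by
        rw [hq]
        gcongr
        linarith
  obtain ⟨S, hS, hSR⟩ : ∃ S, IsWeightedInverse (μ - Complex.I * k) ψ ω q S ∧
      (7 ≤ t → IsWeightedInverse (μ - Complex.I * k) ω ω (1 / (γ + (μ.re + k.im))) S) := by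
    rcases le_total 0 ((μ - Complex.I * k).re + γ) with h | h
    · refine ⟨_, hSinf _ h, fun ht7 => ?_⟩
      rw [← hre₂]
      exact hR _ (by rw [hre₂]; linarith)
    · have hexp : L * Real.exp (-ε * (Real.log (L * ε / 3) / ε)) = 3 / ε := by
        have : -ε * (Real.log (L * ε / 3) / ε) = -Real.log (L * ε / 3) := by field_simp
        rw [this, Real.exp_neg, Real.exp_log (by positivity)]
        field_simp
      refine ⟨solveFromPoint (Real.log (L * ε / 3) / ε) (μ - Complex.I * k), ?_, fun ht7 => ?_⟩
      · have := isWeightedInverse_solveFromPoint (x₁ := Real.log (L * ε / 3) / ε) hε hL h (by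
          rw [mul_right_comm, hexp, div_mul_cancel₀ _ hε.ne', hre₂]
          linarith)
        rwa [decayWeight, hexp, neg_zero, zero_mul, zero_add] at this
      · rw [hre₂] at h
        linarith
  have hρ₁ : 0 ≤ (μ + Complex.I * k).re := by rw [hre₁]; linarith
  have hρ₂ : 0 ≤ (0 : ℂ).re := le_rfl
  have hσ₂ : 0 ≤ (2 * μ).re := by rw [hre₃]; linarith
  obtain ⟨a₁, a₂, hac₁, hac₂, hab₁, hab₂, hfix₁, hfix₂⟩ :=
    exists_solution_integral_system hA hB (continuous_decayWeight γ ε L) hωpos hA0 hB0 hw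
      (by positivity) hψ hψω hS (hSinf (2 * μ) (by linarith)) (hRγ _ hρ₁) (hRγ _ hρ₂) hLs
  set n₁ := solveFromInfinity (μ + Complex.I * k) a₁ with hn₁
  set n₂ := solveFromInfinity 0 a₂ with hn₂
  have hnb₁ := (hRγ _ hρ₁).bound a₁ hac₁ Q hQ0 hab₁
  have hnb₂ := (hRγ _ hρ₂).bound a₂ hac₂ Q hQ0 hab₂
  have hnc₁ := (hRγ _ hρ₁).continuous hac₁ hQ0 hab₁
  have hnc₂ := (hRγ _ hρ₂).continuous hac₂ hQ0 hab₂
  have hgc₁ := continuous_jostForcing hA hB hnc₁ hnc₂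
  have hgc₂ := continuous_jostForcing hB hA hnc₁ hnc₂
  have hQγ : 0 ≤ Q * (1 / γ) := by positivity
  have hgψ₁ := fun y => norm_jostForcing_le (hA0 y) (hB0 y) (hψ y) (hψω y) hQγ (hnb₁ y) (hnb₂ y)
  have hgψ₂ := fun y =>
    norm_jostForcing_le (hB0 y) (hA0 y) (hψ' y) (hψω' y) hQγ (hnb₁ y) (hnb₂ y)
  have hgω₁ := fun y => norm_jostForcing_le (hA0 y) (hB0 y) (hω₁ y) (hωω y) hQγ (hnb₁ y) (hnb₂ y)
  have hgω₂ := fun y =>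
    norm_jostForcing_le (hB0 y) (hA0 y) (hω₁' y) (hωω' y) hQγ (hnb₁ y) (hnb₂ y)
  have hg0 : 0 ≤ w * (1 + Q * (1 / γ)) := by positivity
  have hinv8 : t ≤ 7 → 1 ≤ 8 * (1 + t)⁻¹ := by
    intro h
    rw [← div_eq_mul_inv, one_le_div (by positivity)]
    linarith
  have hlarge : ∀ (σ : ℂ) (T : (ℝ → ℂ) → ℝ → ℂ) (s : ℝ) (g a : ℝ → ℂ), Continuous g →
      (7 ≤ t → IsWeightedInverse σ ω ω (1 / (γ + s)) T) → t - 3 ≤ s → T g = a →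
      (∀ y, ‖g y‖ ≤ w * (1 + Q * (1 / γ)) * ω y) → (∀ y, ‖a y‖ ≤ Q * ω y) →
      ∀ y, ‖a y‖ ≤ P * (1 + t)⁻¹ * ω y := by
    intro σ T s g a hg hT hs hTg hgb hab y
    rcases le_total t 7 with h | h
    · refine (hab y).trans (mul_le_mul_of_nonneg_right ?_ (hωpos y).le)
      calc Q ≤ Q * (8 * (1 + t)⁻¹) := le_mul_of_one_le_right hQ0 (hinv8 h)
        _ = 8 * Q * (1 + t)⁻¹ := by ring
        _ ≤ P * (1 + t)⁻¹ := by gcongr; rw [hP]; linarith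
    · rw [← hTg]
      refine ((hT h).bound g hg _ hg0 hgb y).trans (mul_le_mul_of_nonneg_right ?_ (hωpos y).le)
      calc w * (1 + Q * (1 / γ)) * (1 / (γ + s))
          ≤ w * (1 + Q * (1 / γ)) * (2 * (1 + t)⁻¹) := by
            gcongr
            exact one_div_add_le_of_norm_sub_le hγ h hs
        _ = w * (1 + Q * (1 / γ)) * 2 * (1 + t)⁻¹ := by ring
        _ ≤ P * (1 + t)⁻¹ := by gcongr; rw [hP]; linarith
  have hap₁ := hlarge _ S _ _ _ hgc₁ hSR hm₂ hfix₁ hgω₁ hab₁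
  have hap₂ := hlarge _ _ _ _ _ hgc₂ (fun _ => hR _ hσ₂) (hm₃.trans_eq hre₃.symm) hfix₂ hgω₂ hab₂
  have hPt : 0 ≤ P * (1 + t)⁻¹ := by positivity
  have hC : ∀ c x, c ≤ 5 + 17 / γ →
      P * (1 + t)⁻¹ * c * ω x ≤ P * (5 + 17 / γ) * (1 + t)⁻¹ * ω x := by
    intro c x hc
    calc P * (1 + t)⁻¹ * c * ω x ≤ P * (1 + t)⁻¹ * (5 + 17 / γ) * ω x :=
          mul_le_mul_of_nonneg_right (mul_le_mul_of_nonneg_left hc hPt) (hωpos x).le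
      _ = P * (5 + 17 / γ) * (1 + t)⁻¹ * ω x := by ring
  have hγ1 : 1 / γ ≤ 5 + 17 / γ := by
    have : 1 / γ ≤ 17 / γ := by gcongr; norm_num
    linarith
  have hγ2 : 0 < 17 / γ := by positivity
  refine ⟨n₁, n₂, a₁, a₂, ?_, ?_, ?_, ?_, ?_, ?_, ?_, ?_⟩
  · exact (hRγ _ hρ₁).hasDerivAt a₁ hac₁ Q hQ0 hab₁
  · intro x
    simpa using (hRγ _ hρ₂).hasDerivAt a₂ hac₂ Q hQ0 hab₂ x
  · intro x
    have := hS.hasDerivAt _ hgc₁ _ hg0 hgψ₁ x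
    rwa [hfix₁] at this
  · intro x
    have := (hSinf (2 * μ) (by linarith)).hasDerivAt _ hgc₂ _ hg0 hgψ₂ x
    rwa [hfix₂] at this
  · exact fun x => ((hRγ _ hρ₁).bound a₁ hac₁ _ hPt hap₁ x).trans (hC _ x hγ1)
  · exact fun x => ((hRγ _ hρ₂).bound a₂ hac₂ _ hPt hap₂ x).trans (hC _ x hγ1)
  · intro x
    have hn := (hR _ hρ₁).bound a₁ hac₁ _ hPt hap₁ x
    have hr : ‖μ + Complex.I * k‖ ≤ 2 * (1 + t) := by
      refine (norm_add_le _ _).trans ?_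
      rw [norm_mul, Complex.norm_I, one_mul]
      linarith
    have hfac : 2 * (1 + t) * (1 / (γ + (μ + Complex.I * k).re)) ≤ 4 + 16 / γ := by
      have h16 : 0 < 16 / γ := by positivity
      rcases le_total t 7 with h | h
      · calc 2 * (1 + t) * (1 / (γ + (μ + Complex.I * k).re)) ≤ 2 * (1 + 7) * (1 / γ) := by
              gcongr
              linarith
          _ = 16 / γ := by ring
          _ ≤ 4 + 16 / γ := by linarith
      · calc 2 * (1 + t) * (1 / (γ + (μ + Complex.I * k).re))
            ≤ 2 * (1 + t) * (2 * (1 + t)⁻¹) := by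
              gcongr
              exact one_div_add_le_of_norm_sub_le hγ h (by rw [hre₁]; exact hm₁)
          _ = 4 := by field_simp; norm_num
          _ ≤ 4 + 16 / γ := by linarith
    calc ‖(μ + Complex.I * k) * n₁ x + a₁ x‖
        ≤ ‖μ + Complex.I * k‖ * ‖n₁ x‖ + ‖a₁ x‖ := by
          rw [← norm_mul]; exact norm_add_le _ _
      _ ≤ 2 * (1 + t) * (P * (1 + t)⁻¹ * (1 / (γ + (μ + Complex.I * k).re)) * ω x) +
            P * (1 + t)⁻¹ * ω x := by
          gcongr
          exact hap₁ x
      _ = P * (1 + t)⁻¹ * (2 * (1 + t) * (1 / (γ + (μ + Complex.I * k).re)) + 1) * ω x := by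
          ring
      _ ≤ _ := by
          refine hC _ x ?_
          have : 16 / γ ≤ 17 / γ := by gcongr; norm_num
          linarith
  · intro x
    refine (hap₂ x).trans ?_
    simpa using hC 1 x (by linarith)

/-! ### The ground state potential and the dispersion relation -/

theorem groundState_rpow {p : ℝ} (hp : 1 < p) (x : ℝ) :
    groundState p x ^ (p - 1) = (p + 1) / 2 * (1 / Real.cosh ((p - 1) * x / 2)) ^ 2 := by
  have hp' : p - 1 ≠ 0 := by linarith
  have hc : 0 < Real.cosh ((p - 1) * x / 2) := Real.cosh_pos _
  have hpos : 0 ≤ (p + 1) / 2 := by linarith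
  rw [groundState, Real.mul_rpow (by positivity) (by positivity), ← Real.rpow_mul hpos,
    ← Real.rpow_mul (by positivity), div_mul_cancel₀ _ hp', div_mul_cancel₀ _ hp',
    Real.rpow_one, Real.rpow_two]

theorem continuous_groundState_rpow {p : ℝ} (hp : 1 < p) :
    Continuous fun x => groundState p x ^ (p - 1) := by
  simp_rw [groundState_rpow hp]
  have : ∀ x, Real.cosh ((p - 1) * x / 2) ≠ 0 := fun x => (Real.cosh_pos _).ne'
  have hc := Real.continuous_cosh
  fun_prop (disch := exact this _)

theorem groundState_rpow_nonneg {p : ℝ} (hp : 1 < p) (x : ℝ) :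
    0 ≤ groundState p x ^ (p - 1) := by
  rw [groundState_rpow hp]
  have : 0 ≤ (p + 1) / 2 := by linarith
  positivity

theorem groundState_rpow_le {p s : ℝ} (hp : 1 < p) (hs₀ : 0 ≤ s) (hs : s ≤ p - 1) (x : ℝ) :
    groundState p x ^ (p - 1) ≤ 2 * (p + 1) * Real.exp (-s * x) := by
  rw [groundState_rpow hp]
  have hsx : -((p - 1) * |x|) ≤ -s * x := by
    have h1 : s * |x| ≤ (p - 1) * |x| := mul_le_mul_of_nonneg_right hs (abs_nonneg x)
    have h2 : s * x ≤ s * |x| := mul_le_mul_of_nonneg_left (le_abs_self x) hs₀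
    linarith
  have hcosh : Real.exp ((p - 1) * |x| / 2) / 2 ≤ Real.cosh ((p - 1) * x / 2) := by
    rw [← Real.cosh_abs, abs_div, abs_mul, abs_of_pos (by linarith : 0 < p - 1), abs_two,
      Real.cosh_eq]
    have := Real.exp_pos (-((p - 1) * |x| / 2))
    linarith
  have hsech : (1 / Real.cosh ((p - 1) * x / 2)) ^ 2 ≤ 4 * Real.exp (-s * x) := by
    calc (1 / Real.cosh ((p - 1) * x / 2)) ^ 2
        ≤ (1 / (Real.exp ((p - 1) * |x| / 2) / 2)) ^ 2 := by
          gcongr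
      _ = 4 * Real.exp (-((p - 1) * |x|)) := by
          have : Real.exp (-((p - 1) * |x|)) = (Real.exp ((p - 1) * |x| / 2))⁻¹ ^ 2 := by
            rw [← Real.exp_neg, ← Real.exp_nat_mul]
            congr 1
            push_cast
            ring
          rw [this]
          field_simp
          norm_num
      _ ≤ 4 * Real.exp (-s * x) := by gcongr
  calc (p + 1) / 2 * (1 / Real.cosh ((p - 1) * x / 2)) ^ 2
      ≤ (p + 1) / 2 * (4 * Real.exp (-s * x)) := mul_le_mul_of_nonneg_left hsech (by linarith)
    _ = 2 * (p + 1) * Real.exp (-s * x) := by ring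

theorem cpow_one_half_sq (z : ℂ) : (z ^ ((1 : ℂ) / 2)) ^ 2 = z := by
  rw [one_div]
  exact Complex.cpow_ofNat_inv_pow z 2

theorem cpow_one_half_re_nonneg (z : ℂ) : 0 ≤ (z ^ ((1 : ℂ) / 2)).re := by
  rw [one_div, Complex.cpow_inv_two_re]
  exact Real.sqrt_nonneg _

theorem contDiff_two_of_hasDerivAt {f f' f'' : ℝ → ℂ} (hf : ∀ x, HasDerivAt f (f' x) x)
    (hf' : ∀ x, HasDerivAt f' (f'' x) x) (hc : Continuous f'') :
    ContDiff ℝ 2 f ∧ deriv (deriv f) = f'' := by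
  have h1 : deriv f = f' := funext fun x => (hf x).deriv
  have h2 : deriv f' = f'' := funext fun x => (hf' x).deriv
  refine ⟨?_, by rw [h1, h2]⟩
  rw [show (2 : WithTop ℕ∞) = 1 + 1 from (one_add_one_eq_two).symm, contDiff_succ_iff_deriv]
  refine ⟨fun x => (hf x).differentiableAt, by simp, ?_⟩
  rw [h1, contDiff_one_iff_deriv, h2]
  exact ⟨fun x => (hf' x).differentiableAt, hc⟩

theorem HasDerivAt.cexp_neg_mul {n : ℝ → ℂ} {n' μ : ℂ} {x : ℝ} (hn : HasDerivAt n n' x) :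
    HasDerivAt (fun y : ℝ => Complex.exp (-(y * μ)) * n y)
      (Complex.exp (-(x * μ)) * (-μ * n x + n')) x := by
  have h : HasDerivAt (fun y : ℝ => (y : ℂ) * μ) μ x := by
    simpa using (hasDerivAt_id x).ofReal_comp.mul_const μ
  exact (h.fun_neg.cexp.fun_mul hn).congr_deriv (by ring)

/-- The Jost solution is `f = exp(-μx) (n₁, 1 + n₂)`. -/
theorem exists_jost_solution {A B : ℝ → ℝ} {γ ε w x₀ : ℝ} (hA : Continuous A)
    (hB : Continuous B) (hA0 : ∀ y, 0 ≤ A y) (hB0 : ∀ y, 0 ≤ B y) (hγ : 0 < γ) (hε : 0 < ε)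
    (hw : 0 ≤ w) (hAB : ∀ s, 0 ≤ s → s ≤ γ + ε → ∀ y, A y + B y ≤ w * Real.exp (-s * y)) :
    ∃ C > 0, ∀ k μ : ℂ, μ ^ 2 = 2 + k ^ 2 → 0 ≤ μ.re → -Real.sqrt 2 ≤ k.im →
      k.im ≤ 1 → ∃ f₁ f₂ : ℝ → ℂ, (ContDiff ℝ 2 f₁ ∧ ContDiff ℝ 2 f₂) ∧
        (∀ x, -(deriv (deriv f₁) x) + f₁ x - A x * f₁ x - B x * f₂ x = (k ^ 2 + 1) * f₁ x ∧
          deriv (deriv f₂) x - f₂ x + B x * f₁ x + A x * f₂ x = (k ^ 2 + 1) * f₂ x) ∧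
        ∀ x, x₀ ≤ x →
          ‖(Complex.exp (x * μ) * f₁ x, Complex.exp (x * μ) * f₂ x - 1)‖
            ≤ C * (1 + ‖k‖)⁻¹ * Real.exp (-γ * x) ∧
          ‖(deriv (fun y : ℝ => Complex.exp (y * μ) * f₁ y) x,
            deriv (fun y : ℝ => Complex.exp (y * μ) * f₂ y) x)‖
            ≤ C * (1 + ‖k‖)⁻¹ * Real.exp (-γ * x) := by
  obtain ⟨C, hC, L, hL, h⟩ := exists_jost_system hA hB hA0 hB0 hγ hε hw hAB
  refine ⟨C * decayWeight 0 ε L x₀, mul_pos hC (decayWeight_pos _ _ _ _), ?_⟩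
  intro k μ hμ hre hk₁ hk₂
  obtain ⟨n₁, n₂, a₁, a₂, hn₁, hn₂, ha₁, ha₂, hb₁, hb₂, hb₃, hb₄⟩ := h k μ hμ hre hk₁ hk₂
  have hnc₁ : Continuous n₁ := continuous_iff_continuousAt.2 fun x => (hn₁ x).continuousAt
  have hnc₂ : Continuous n₂ := continuous_iff_continuousAt.2 fun x => (hn₂ x).continuousAt
  have hgc₁ := continuous_jostForcing hA hB hnc₁ hnc₂
  have hgc₂ := continuous_jostForcing hB hA hnc₁ hnc₂
  have hf₁' : ∀ x : ℝ, HasDerivAt (fun y : ℝ => Complex.exp (-(y * μ)) * n₁ y)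
      (Complex.exp (-(x * μ)) * (Complex.I * k * n₁ x + a₁ x)) x := by
    intro x
    convert (hn₁ x).cexp_neg_mul (μ := μ) using 1
    ring
  have hf₁'' : ∀ x : ℝ, HasDerivAt
      (fun y : ℝ => Complex.exp (-(y * μ)) * (Complex.I * k * n₁ y + a₁ y))
      (Complex.exp (-(x * μ)) * (-k ^ 2 * n₁ x + jostForcing A B n₁ n₂ x)) x := by
    intro x
    convert (((hn₁ x).const_mul (Complex.I * k)).fun_add (ha₁ x)).cexp_neg_mul (μ := μ) using 1
    linear_combination -(Complex.exp (-(x * μ)) * k ^ 2 * n₁ x) * Complex.I_sq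
  have hf₂' : ∀ x : ℝ, HasDerivAt (fun y : ℝ => Complex.exp (-(y * μ)) * (1 + n₂ y))
      (Complex.exp (-(x * μ)) * (-μ * (1 + n₂ x) + a₂ x)) x := fun x =>
    ((hn₂ x).const_add 1).cexp_neg_mul
  have hf₂'' : ∀ x : ℝ, HasDerivAt
      (fun y : ℝ => Complex.exp (-(y * μ)) * (-μ * (1 + n₂ y) + a₂ y))
      (Complex.exp (-(x * μ)) * (μ ^ 2 * (1 + n₂ x) + jostForcing B A n₁ n₂ x)) x := by
    intro x
    convert ((((hn₂ x).const_add 1).const_mul (-μ)).fun_add (ha₂ x)).cexp_neg_mul (μ := μ) using 1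
    ring
  obtain ⟨hs₁, hd₁⟩ := contDiff_two_of_hasDerivAt hf₁' hf₁'' (by fun_prop)
  obtain ⟨hs₂, hd₂⟩ := contDiff_two_of_hasDerivAt hf₂' hf₂'' (by fun_prop)
  refine ⟨_, _, ⟨hs₁, hs₂⟩, fun x => ?_, fun x hx => ?_⟩
  · rw [hd₁, hd₂, hμ]
    simp only [jostForcing]
    constructor <;> ring
  · have hcancel : ∀ (y : ℝ) (z : ℂ), Complex.exp (y * μ) * (Complex.exp (-(y * μ)) * z) = z := by
      intro y z
      rw [← mul_assoc, ← Complex.exp_add, add_neg_cancel, Complex.exp_zero, one_mul]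
    have hle : C * (1 + ‖k‖)⁻¹ * decayWeight γ ε L x ≤
        C * decayWeight 0 ε L x₀ * (1 + ‖k‖)⁻¹ * Real.exp (-γ * x) := by
      calc C * (1 + ‖k‖)⁻¹ * decayWeight γ ε L x
          ≤ C * (1 + ‖k‖)⁻¹ * (decayWeight 0 ε L x₀ * Real.exp (-γ * x)) := by
            gcongr
            exact decayWeight_le hε.le hL.le hx
        _ = _ := by ring
    simp only [hcancel, add_sub_cancel_left]
    rw [(hn₁ x).deriv, ((hn₂ x).const_add 1).deriv, norm_prod_le_iff, norm_prod_le_iff]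
    exact ⟨⟨(hb₁ x).trans hle, (hb₂ x).trans hle⟩, (hb₃ x).trans hle, (hb₄ x).trans hle⟩

/-- existence of the Jost solution `f₃(x,k)` of the linearized system
`H u⃗ = (k²+1) u⃗` on the strip `S₃ = {−√2 ≤ Im k ≤ 1}`, with
`m₃(x,k) = e^{x√(2+k²)} f₃(x,k)` close to `(0,1)` as `x → +∞`. -/
theorem stmt_5 (p γ x₀ : ℝ) (hp : 1 < p) (hγ0 : 0 < γ) (hγ : γ < p - 1) :
    ∃ C > (0 : ℝ), ∃ f₃ : ℝ → ℂ → ℂ × ℂ,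
      ∀ k : ℂ, -Real.sqrt 2 ≤ k.im → k.im ≤ 1 →
        (ContDiff ℝ 2 (fun x : ℝ => (f₃ x k).1) ∧
         ContDiff ℝ 2 (fun x : ℝ => (f₃ x k).2)) ∧
        (∀ x : ℝ,
          (-(deriv (deriv (fun y : ℝ => (f₃ y k).1)) x) + (f₃ x k).1
            - ((((p + 1) / 2) * groundState p x ^ (p - 1) : ℝ) : ℂ) * (f₃ x k).1
            - ((((p - 1) / 2) * groundState p x ^ (p - 1) : ℝ) : ℂ) * (f₃ x k).2
            = (k ^ 2 + 1) * (f₃ x k).1) ∧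
          (deriv (deriv (fun y : ℝ => (f₃ y k).2)) x - (f₃ x k).2
            + ((((p - 1) / 2) * groundState p x ^ (p - 1) : ℝ) : ℂ) * (f₃ x k).1
            + ((((p + 1) / 2) * groundState p x ^ (p - 1) : ℝ) : ℂ) * (f₃ x k).2
            = (k ^ 2 + 1) * (f₃ x k).2)) ∧
        (∀ x : ℝ, x₀ ≤ x →
          ‖(Complex.exp ((x : ℂ) * (2 + k ^ 2) ^ ((1 : ℂ) / 2)) * (f₃ x k).1,
            Complex.exp ((x : ℂ) * (2 + k ^ 2) ^ ((1 : ℂ) / 2)) * (f₃ x k).2 - 1)‖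
            ≤ C * (1 + ‖k‖)⁻¹ * Real.exp (-γ * x) ∧
          ‖(deriv (fun y : ℝ =>
              Complex.exp ((y : ℂ) * (2 + k ^ 2) ^ ((1 : ℂ) / 2)) * (f₃ y k).1) x,
            deriv (fun y : ℝ =>
              Complex.exp ((y : ℂ) * (2 + k ^ 2) ^ ((1 : ℂ) / 2)) * (f₃ y k).2) x)‖
            ≤ C * (1 + ‖k‖)⁻¹ * Real.exp (-γ * x)) := by
  have hV := groundState_rpow_nonneg hp
  have hVc := continuous_groundState_rpow hp
  obtain ⟨C, hC, h⟩ := exists_jost_solution (A := fun y => (p + 1) / 2 * groundState p y ^ (p - 1))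
    (B := fun y => (p - 1) / 2 * groundState p y ^ (p - 1)) (γ := γ) (ε := p - 1 - γ)
    (w := p * (2 * (p + 1))) (x₀ := x₀) (by fun_prop) (by fun_prop)
    (fun y => mul_nonneg (by linarith) (hV y)) (fun y => mul_nonneg (by linarith) (hV y))
    hγ0 (by linarith) (by positivity) (fun s hs₀ hs y => by
      have := mul_le_mul_of_nonneg_left
        (groundState_rpow_le hp hs₀ (by linarith) y) (by linarith : 0 ≤ p)
      linarith)
  refine ⟨C, hC, ?_⟩
  have h' : ∀ k : ℂ, ∃ f₁ f₂ : ℝ → ℂ, -Real.sqrt 2 ≤ k.im → k.im ≤ 1 → _ := fun k =>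
    if hk : -Real.sqrt 2 ≤ k.im ∧ k.im ≤ 1 then by
      obtain ⟨f₁, f₂, hf⟩ := h k _ (cpow_one_half_sq _) (cpow_one_half_re_nonneg _) hk.1 hk.2
      exact ⟨f₁, f₂, fun _ _ => hf⟩
    else ⟨0, 0, fun h₁ h₂ => absurd ⟨h₁, h₂⟩ hk⟩
  choose f₁ f₂ hf using h'
  exact ⟨fun x k => (f₁ k x, f₂ k x), hf⟩
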